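/- Let (E, ℰ, Q) be a probability space, and let φ, φ_j : ℝ^d × E → ℝ^d (j ∈ ℕ) be jointly measurable maps such that s ↦ ∫ f(φ(s, e)) Q(de) is continuous for every bounded continuous f : ℝ^d → ℝ. Suppose that for every bounded continuous f : ℝ^d → ℝ, sup_{s ∈ ℝ^d} ∫ |f(φ_j(s, e)) − f(φ(s, e))| Q(de) → 0 as j → ∞. Let μ_j* be a Borel probability measure on ℝ^d that is invariant for φ_j (i.e., ∫∫ f(φ_j(s, e)) Q(de) dμ_j*(s) = ∫ f dμ_j* for every bounded continuous f), for each j. If μ* is a weak limit point of the sequence {μ_j*} (i.e., some subsequence μ_{j_k}* converges weakly to μ*), then μ* is invariant for φ: ∫∫ f(φ(s, e)) Q(de) dμ*(s) = ∫ f dμ* for every bounded continuous f : ℝ^d → ℝ. -/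

import Mathlib

open MeasureTheory Filter BoundedContinuousFunction

/-- The average of a bounded continuous function along a Feller transition, as a bounded
continuous function of the state. -/
noncomputable def fellerAverage {S E : Type*} [TopologicalSpace S] [MeasurableSpace E]
    (Q : Measure E) [IsProbabilityMeasure Q] (φ : S → E → S) (f : S →ᵇ ℝ)
    (hf : Continuous fun s => ∫ e, f (φ s e) ∂Q) : S →ᵇ ℝ :=
  BoundedContinuousFunction.ofNormedAddCommGroup (fun s => ∫ e, f (φ s e) ∂Q) hf ‖f‖ fun s => by
    simpa using norm_integral_le_of_norm_le_const (μ := Q)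
      (Eventually.of_forall fun e => f.norm_coe_le_norm (φ s e))

theorem integrable_boundedContinuous_comp {S E : Type*} [TopologicalSpace S] [MeasurableSpace S]
    [OpensMeasurableSpace S] [MeasurableSpace E] (Q : Measure E) [IsFiniteMeasure Q]
    (f : S →ᵇ ℝ) {g : E → S} (hg : Measurable g) : Integrable (fun e => f (g e)) Q :=
  Integrable.of_bound (f.continuous.measurable.comp hg).aestronglyMeasurable ‖f‖
    (Eventually.of_forall fun e => f.norm_coe_le_norm (g e))

/-- The averages of a bounded continuous function along two transitions, integrated over the
state, differ by at most the largest averaged difference over all states. -/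
theorem abs_integral_integral_sub_le_iSup {S E : Type*} [TopologicalSpace S] [MeasurableSpace S]
    [OpensMeasurableSpace S] [MeasurableSpace E] (Q : Measure E) [IsProbabilityMeasure Q]
    (μ : Measure S) [IsProbabilityMeasure μ] {φ ψ : S → E → S}
    (hφ : Measurable (Function.uncurry φ)) (hψ : Measurable (Function.uncurry ψ)) (f : S →ᵇ ℝ) :
    |∫ s, ∫ e, f (ψ s e) ∂Q ∂μ - ∫ s, ∫ e, f (φ s e) ∂Q ∂μ| ≤
      ⨆ s, ∫ e, |f (ψ s e) - f (φ s e)| ∂Q := by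
  have hbdd : BddAbove (Set.range fun s => ∫ e, |f (ψ s e) - f (φ s e)| ∂Q) := by
    refine ⟨2 * ‖f‖, ?_⟩
    rintro _ ⟨s, rfl⟩
    have h := norm_integral_le_of_norm_le_const (μ := Q) (C := 2 * ‖f‖)
      (f := fun e => |f (ψ s e) - f (φ s e)|) (Eventually.of_forall fun e => by
        simpa [Real.dist_eq] using f.dist_le_two_norm (ψ s e) (φ s e))
    simpa using (le_abs_self _).trans h
  have hint {χ : S → E → S} (hχ : Measurable (Function.uncurry χ)) :
      Integrable (fun s => ∫ e, f (χ s e) ∂Q) μ :=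
    (integrable_boundedContinuous_comp (μ.prod Q) f hχ).integral_prod_left
  rw [← integral_sub (hint hψ) (hint hφ), ← Real.norm_eq_abs]
  have h := norm_integral_le_of_norm_le_const (μ := μ)
    (C := ⨆ s, ∫ e, |f (ψ s e) - f (φ s e)| ∂Q)
    (f := fun s => ∫ e, f (ψ s e) ∂Q - ∫ e, f (φ s e) ∂Q) (Eventually.of_forall fun s => by
      rw [← integral_sub
        (integrable_boundedContinuous_comp Q f (g := ψ s) (hψ.comp measurable_prodMk_left))
        (integrable_boundedContinuous_comp Q f (g := φ s) (hφ.comp measurable_prodMk_left))]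
      exact (norm_integral_le_integral_norm _).trans (le_ciSup hbdd s))
  simpa using h

/-- If `φ_j` converge to `φ` (uniformly in the state, after composing with any bounded
continuous test function and averaging over the shock), the transition of `φ` is Feller,
each `μ_j*` is invariant for `φ_j`, and `μ*` is a weak limit point of `{μ_j*}`, then
`μ*` is invariant for `φ`. -/
theorem weak_limit_point_is_invariant
    (d : ℕ) {E : Type*} [MeasurableSpace E] (Q : Measure E) [IsProbabilityMeasure Q]
    (φ : (Fin d → ℝ) → E → (Fin d → ℝ)) (φj : ℕ → (Fin d → ℝ) → E → (Fin d → ℝ))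
    (hφ : Measurable (Function.uncurry φ))
    (hφj : ∀ j, Measurable (Function.uncurry (φj j)))
    -- the transition associated with φ is Feller
    (hfeller : ∀ f : (Fin d → ℝ) →ᵇ ℝ, Continuous fun s => ∫ e, f (φ s e) ∂Q)
    -- uniform-in-state convergence of φ_j to φ against bounded continuous test functions
    (hconv : ∀ f : (Fin d → ℝ) →ᵇ ℝ,
      Tendsto (fun j => ⨆ s : (Fin d → ℝ), ∫ e, |f (φj j s e) - f (φ s e)| ∂Q)
        atTop (nhds 0))
    (μj : ℕ → Measure (Fin d → ℝ)) [∀ j, IsProbabilityMeasure (μj j)]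
    -- each μ_j* is invariant for φ_j
    (hinvj : ∀ j, ∀ f : (Fin d → ℝ) →ᵇ ℝ,
      ∫ s, ∫ e, f (φj j s e) ∂Q ∂(μj j) = ∫ s, f s ∂(μj j))
    (μstar : Measure (Fin d → ℝ)) [IsProbabilityMeasure μstar]
    -- μ* is a weak limit point of {μ_j*}
    (hlim : ∃ k : ℕ → ℕ, StrictMono k ∧ ∀ f : (Fin d → ℝ) →ᵇ ℝ,
      Tendsto (fun i => ∫ s, f s ∂(μj (k i))) atTop (nhds (∫ s, f s ∂μstar))) :
    ∀ f : (Fin d → ℝ) →ᵇ ℝ, ∫ s, ∫ e, f (φ s e) ∂Q ∂μstar = ∫ s, f s ∂μstar := by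
  intro f
  obtain ⟨k, hk, hweak⟩ := hlim
  have hleft : Tendsto (fun i => ∫ s, ∫ e, f (φ s e) ∂Q ∂(μj (k i))) atTop
      (nhds (∫ s, ∫ e, f (φ s e) ∂Q ∂μstar)) :=
    hweak (fellerAverage Q φ f (hfeller f))
  have hdiff : Tendsto (fun i => ∫ s, f s ∂(μj (k i)) - ∫ s, ∫ e, f (φ s e) ∂Q ∂(μj (k i)))
      atTop (nhds 0) := by
    refine squeeze_zero_norm (fun i => ?_) ((hconv f).comp hk.tendsto_atTop)
    rw [← hinvj (k i) f]
    exact abs_integral_integral_sub_le_iSup Q (μj (k i)) hφ (hφj (k i)) f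
  exact (sub_eq_zero.mp (tendsto_nhds_unique ((hweak f).sub hleft) hdiff)).symm
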